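/- Let 1 ≤ r ≤ n be integers, I ⊆ {1,…,n} with |I| = r − 1, i_r ∉ I, and I' = I ∪ {i_r}. Let Γ = Δ(r,n) ∩ {x ∈ ℝⁿ : xᵢ = 1 for all i ∈ I}. Then the smallest convex cone in ℝⁿ containing {x − e_{I'} : x ∈ Γ} equals the convex cone generated by the vectors {e_j − e_{i_r} : j ∉ I'}. -/

import Mathlib

/-- The hypersimplex `Δ(r,n) = {x ∈ ℝⁿ : ∑ᵢ xᵢ = r, 0 ≤ xᵢ ≤ 1}`. -/
def hypersimplex (r n : ℕ) : Set (Fin n → ℝ) :=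
  {x | (∑ i, x i) = (r : ℝ) ∧ ∀ i, 0 ≤ x i ∧ x i ≤ 1}

/-- For `S ⊆ {1,…,n}`, the 0/1 vector `e_S = ∑_{i ∈ S} eᵢ`. -/
def vertexVec {n : ℕ} (S : Finset (Fin n)) : Fin n → ℝ :=
  fun i => if i ∈ S then 1 else 0

/-- A pointed convex cone: a set containing `0`, closed under addition and under
multiplication by nonnegative real scalars. -/
def IsPointedCone {E : Type*} [AddCommMonoid E] [Module ℝ E] (C : Set E) : Prop :=
  (0 : E) ∈ C ∧ (∀ x ∈ C, ∀ y ∈ C, x + y ∈ C) ∧ ∀ c : ℝ, 0 ≤ c → ∀ x ∈ C, c • x ∈ C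

/-- The smallest pointed convex cone containing a set `S`. -/
def coneHull {E : Type*} [AddCommMonoid E] [Module ℝ E] (S : Set E) : Set E :=
  ⋂₀ {C : Set E | S ⊆ C ∧ IsPointedCone C}

theorem aux_sum_mem {E ι : Type*} [AddCommMonoid E] [Module ℝ E] {C : Set E}
    (hC : IsPointedCone C) (s : Finset ι) (f : ι → E) (h : ∀ i ∈ s, f i ∈ C) :
    ∑ i ∈ s, f i ∈ C := by
  classical
  induction s using Finset.induction_on with
  | empty => simpa using hC.1
  | insert a s ha ih =>
    rw [Finset.sum_insert ha]
    exact hC.2.1 _ (h a (by simp)) _ (ih fun i hi => h i (by simp [hi]))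

/-- The cone at the vertex `e_{I'}` (`I' = I ∪ {i_r}`, `|I| = r − 1`, `i_r ∉ I`) of the face
`Γ = Δ(r,n) ∩ {xᵢ = 1 for all i ∈ I}` is generated by the vectors `e_j − e_{i_r}`, `j ∉ I'`. -/
theorem vertex_cone_face (r n : ℕ) (h1 : 1 ≤ r) (hrn : r ≤ n)
    (I : Finset (Fin n)) (hI : I.card = r - 1) (ir : Fin n) (hir : ir ∉ I) :
    coneHull {y : Fin n → ℝ |
        ∃ x ∈ hypersimplex r n ∩ {x : Fin n → ℝ | ∀ i ∈ I, x i = 1},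
          y = x - vertexVec (insert ir I)} =
      coneHull {v : Fin n → ℝ | ∃ j ∉ insert ir I, v = vertexVec {j} - vertexVec {ir}} := by
  apply Set.Subset.antisymm
  · rintro y hy C ⟨hSC, hC⟩
    refine hy C ⟨?_, hC⟩
    rintro _ ⟨x, ⟨⟨hsum, hx⟩, hxI⟩, rfl⟩
    have hsplit := Finset.sum_add_sum_compl (insert ir I) x
    have hsI : ∑ i ∈ I, x i = (r : ℝ) - 1 := by
      rw [Finset.sum_congr rfl hxI]
      simp [hI, Nat.cast_sub h1]
    rw [Finset.sum_insert hir, hsI, hsum] at hsplit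
    have key : x - vertexVec (insert ir I) =
        ∑ j ∈ (insert ir I)ᶜ, x j • (vertexVec {j} - vertexVec {ir}) := by
      funext i
      simp only [Finset.sum_apply, Pi.sub_apply, Pi.smul_apply, smul_eq_mul, mul_sub,
        Finset.sum_sub_distrib, vertexVec, Finset.mem_singleton, mul_ite, mul_one, mul_zero,
        Finset.sum_ite_eq, Finset.mem_compl]
      by_cases h : i = ir
      · subst h
        simp [-Finset.compl_insert]
        linarith
      · by_cases h' : i ∈ I
        · simp [h, h', hxI i h']
        · simp [h, h']
    rw [key]
    exact aux_sum_mem hC _ _ fun j hj => hC.2.2 _ (hx j).1 _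
      (hSC ⟨j, Finset.mem_compl.1 hj, rfl⟩)
  · rintro y hy C ⟨hSC, hC⟩
    refine hy C ⟨?_, hC⟩
    rintro _ ⟨j, hj, rfl⟩
    apply hSC
    have hj' : j ≠ ir ∧ j ∉ I := by simpa using hj
    refine ⟨vertexVec (insert j I), ⟨⟨?_, ?_⟩, ?_⟩, ?_⟩
    · simp only [vertexVec, Finset.sum_ite_mem, Finset.univ_inter, Finset.sum_const,
        Finset.card_insert_of_notMem hj'.2, hI, Nat.sub_add_cancel h1]
      simp
    · intro i
      unfold vertexVec
      split_ifs <;> simp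
    · intro i hi
      simp [vertexVec, hi]
    · funext i
      simp only [vertexVec, Pi.sub_apply, Finset.mem_insert, Finset.mem_singleton]
      by_cases h : i ∈ I
      · have a : i ≠ j := fun e => hj'.2 (e ▸ h)
        have b : i ≠ ir := fun e => hir (e ▸ h)
        simp [h, a, b]
      · simp [h]
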